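/- arXiv:2605.23127 — 2 statements merged into one kernel-verified Lean document; each statement's English description precedes it below -/
import Mathlib

section
/- Let N ∈ ℕ and 0 < α < N. There exists a constant K > 0 such that for all x, y ∈ ℝ^N with x ≠ y, 1/|x − y|^{N−α} = K ∫_{ℝ^N} dz / (|x − z|^{(2N−α)/2} |y − z|^{(2N−α)/2}); in particular the integral on the right-hand side is finite for x ≠ y. -/
open MeasureTheory Real Filter

noncomputable section

abbrev ES (N : ℕ) := EuclideanSpace ℝ (Fin N)

open Metric Module

section RieszComposition

variable {E : Type*} [NormedAddCommGroup E]

/-- The integrand of the composition of two Riesz kernels with poles at `x` and `y`. -/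
def twoPoleKernel (s : ℝ) (x y z : E) : ℝ := (‖x - z‖ ^ s * ‖y - z‖ ^ s)⁻¹

lemma twoPoleKernel_nonneg (s : ℝ) (x y z : E) : 0 ≤ twoPoleKernel s x y z := by
  unfold twoPoleKernel; positivity

lemma measurable_twoPoleKernel [MeasurableSpace E] [BorelSpace E] (s : ℝ) (x y : E) :
    Measurable (twoPoleKernel s x y) := by
  unfold twoPoleKernel; fun_prop

lemma twoPoleKernel_zero_sub (s : ℝ) (e z : E) :
    twoPoleKernel s 0 e (e - z) = twoPoleKernel s 0 e z := by
  simp [twoPoleKernel, mul_comm, norm_sub_rev]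

lemma twoPoleKernel_le_of_half_le {s : ℝ} (hs : 0 ≤ s) {e z : E} (he : ‖e‖ = 1)
    (hz : 1 / 2 ≤ ‖z‖) (hez : 1 / 2 ≤ ‖e - z‖) :
    twoPoleKernel s 0 e z ≤ 15 ^ s * (1 + ‖z‖) ^ (-(2 * s)) := by
  have h : ‖z‖ ≤ 1 + ‖e - z‖ := by
    simpa [he] using norm_sub_le e (e - z)
  have hmul : (1 + ‖z‖) ^ 2 ≤ 15 * (‖z‖ * ‖e - z‖) := by
    nlinarith [mul_le_mul (show 1 + ‖z‖ ≤ 3 * ‖z‖ by linarith)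
      (show 1 + ‖z‖ ≤ 5 * ‖e - z‖ by linarith) (by positivity) (by positivity)]
  have key : ((1 + ‖z‖) ^ 2) ^ s ≤ 15 ^ s * (‖z‖ * ‖e - z‖) ^ s := by
    rw [← Real.mul_rpow (by norm_num) (by positivity)]
    gcongr
  rw [twoPoleKernel, zero_sub, norm_neg, ← Real.mul_rpow (norm_nonneg _) (norm_nonneg _),
    Real.rpow_neg (by positivity), Real.rpow_mul (by positivity), Real.rpow_two]
  have hp : 0 < (‖z‖ * ‖e - z‖) ^ s := Real.rpow_pos_of_pos (by nlinarith) _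
  rw [← div_eq_mul_inv, le_div_iff₀ (by positivity), inv_mul_le_iff₀ hp]
  linarith

variable [InnerProductSpace ℝ E]

lemma exists_linearIsometryEquiv_apply_eq {e : E} (he : ‖e‖ = 1) (v : E) :
    ∃ R : E ≃ₗᵢ[ℝ] E, ‖v‖ • R e = v := by
  refine ⟨Submodule.reflection (ℝ ∙ (‖v‖ • e - v))ᗮ, ?_⟩
  rw [← map_smul]
  exact Submodule.reflection_sub (by simp [norm_smul, he])

lemma twoPoleKernel_similarity (s : ℝ) {x y e : E} (R : E ≃ₗᵢ[ℝ] E)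
    (hR : ‖y - x‖ • R e = y - x) (z : E) :
    twoPoleKernel s x y (x + ‖y - x‖ • R z) =
      (‖y - x‖ ^ (2 * s))⁻¹ * twoPoleKernel s 0 e z := by
  have h1 : ‖x - (x + ‖y - x‖ • R z)‖ = ‖y - x‖ * ‖0 - z‖ := by
    simp [norm_smul]
  have h2 : ‖y - (x + ‖y - x‖ • R z)‖ = ‖y - x‖ * ‖e - z‖ := by
    rw [← sub_sub]
    nth_rw 1 [← hR]
    rw [← smul_sub, ← map_sub, norm_smul, norm_norm, R.norm_map]
  rw [twoPoleKernel, h1, h2, twoPoleKernel, Real.mul_rpow (norm_nonneg _) (norm_nonneg _),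
    Real.mul_rpow (norm_nonneg _) (norm_nonneg _), mul_comm 2 s, Real.rpow_mul (norm_nonneg _),
    Real.rpow_two]
  simp only [mul_inv, pow_two]
  ring

variable [FiniteDimensional ℝ E] [MeasurableSpace E] [BorelSpace E]

lemma integrableOn_ball_twoPoleKernel {s : ℝ} (hs : 0 ≤ s) (hsE : s < finrank ℝ E) {e : E}
    (he : ‖e‖ = 1) : IntegrableOn (twoPoleKernel s 0 e) (ball 0 (1 / 2)) := by
  have hd : 1 ≤ finrank ℝ E := by
    have : (0 : ℝ) < finrank ℝ E := hs.trans_lt hsE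
    exact_mod_cast this
  refine integrableOn_ball_of_norm_le_rpow (C := 2 ^ s) hd hsE ?_
    (measurable_twoPoleKernel s 0 e).aestronglyMeasurable
  refine ae_restrict_of_forall_mem measurableSet_ball fun z hz => ?_
  have hz' : ‖z‖ < 1 / 2 := by simpa using hz
  have hez : 1 / 2 ≤ ‖e - z‖ := by linarith [norm_sub_norm_le e z]
  rw [Real.norm_of_nonneg (twoPoleKernel_nonneg ..), twoPoleKernel, zero_sub, norm_neg, mul_inv,
    ← Real.rpow_neg (norm_nonneg z), mul_comm]
  gcongr
  rw [← Real.inv_rpow (norm_nonneg _)]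
  gcongr
  rw [inv_le_comm₀ (by linarith) two_pos]
  linarith

lemma integrable_twoPoleKernel_unit {s : ℝ} (hs : 0 ≤ s) (hsE : s < finrank ℝ E)
    (hsE' : finrank ℝ E < 2 * s) {e : E} (he : ‖e‖ = 1) : Integrable (twoPoleKernel s 0 e) := by
  have hB := (integrable_indicator_iff measurableSet_ball).2
    (integrableOn_ball_twoPoleKernel hs hsE he)
  refine ((hB.add (hB.comp_sub_left e)).add
    ((integrable_one_add_norm hsE').const_mul (15 ^ s))).mono'
    (measurable_twoPoleKernel s 0 e).aestronglyMeasurable (Eventually.of_forall fun z => ?_)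
  rw [Real.norm_of_nonneg (twoPoleKernel_nonneg ..)]
  have hind (w : E) : 0 ≤ (ball 0 (1 / 2)).indicator (twoPoleKernel s 0 e) w :=
    Set.indicator_nonneg (fun _ _ => twoPoleKernel_nonneg ..) _
  have hJ : 0 ≤ (15 : ℝ) ^ s * (1 + ‖z‖) ^ (-(2 * s)) := by positivity
  simp only [Pi.add_apply]
  by_cases hz : z ∈ ball (0 : E) (1 / 2)
  · have := Set.indicator_of_mem hz (twoPoleKernel s 0 e)
    linarith [hind (e - z)]
  by_cases hez : e - z ∈ ball (0 : E) (1 / 2)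
  · have := Set.indicator_of_mem hez (twoPoleKernel s 0 e)
    rw [twoPoleKernel_zero_sub] at this
    linarith [hind z]
  · rw [mem_ball_zero_iff, not_lt] at hz hez
    linarith [hind z, hind (e - z), twoPoleKernel_le_of_half_le hs he hz hez]

lemma integral_twoPoleKernel_unit_pos {s : ℝ} {e : E} (he : ‖e‖ = 1)
    (hint : Integrable (twoPoleKernel s 0 e)) : 0 < ∫ z, twoPoleKernel s 0 e z := by
  rw [integral_pos_iff_support_of_nonneg (fun z => twoPoleKernel_nonneg s 0 e z) hint]
  refine (measure_ball_pos volume (-e) one_pos).trans_le (measure_mono fun z hz => ?_)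
  rw [mem_ball, dist_eq_norm, sub_neg_eq_add] at hz
  have h0 : 0 - z ≠ 0 := by
    rintro h
    rw [zero_sub, neg_eq_zero] at h
    simp [h, he] at hz
  have h1 : e - z ≠ 0 := by
    rintro h
    rw [← sub_eq_zero.1 h, ← two_smul ℝ, norm_smul, he] at hz
    norm_num at hz
  have := norm_pos_iff.2 h0
  have := norm_pos_iff.2 h1
  rw [Function.mem_support, twoPoleKernel]
  positivity

lemma integrable_and_integral_twoPoleKernel {s : ℝ} {x y e : E} (hxy : x ≠ y) (he : ‖e‖ = 1)
    (hint : Integrable (twoPoleKernel s 0 e)) :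
    Integrable (twoPoleKernel s x y) ∧
      ∫ z, twoPoleKernel s x y z =
        (‖x - y‖ ^ (2 * s - finrank ℝ E))⁻¹ * ∫ z, twoPoleKernel s 0 e z := by
  obtain ⟨R, hR⟩ := exists_linearIsometryEquiv_apply_eq he (y - x)
  have hr : 0 < ‖y - x‖ := norm_pos_iff.2 (sub_ne_zero.2 hxy.symm)
  have hemb : MeasurableEmbedding R := R.toHomeomorph.measurableEmbedding
  have hsim := twoPoleKernel_similarity s R hR
  constructor
  · have h : Integrable (fun z => twoPoleKernel s x y (x + ‖y - x‖ • R z)) := by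
      simp_rw [hsim]
      exact hint.const_mul _
    have h' : Integrable (fun z => twoPoleKernel s x y (x + ‖y - x‖ • z)) :=
      (R.measurePreserving.integrable_comp_emb hemb).1 h
    have h'' := ((integrable_comp_smul_iff volume (fun z => twoPoleKernel s x y (x + z))
      hr.ne').1 h').comp_add_left (-x)
    simpa using h''
  · have h := R.measurePreserving.integral_comp hemb
      (fun z => twoPoleKernel s x y (x + ‖y - x‖ • z))
    rw [Measure.integral_comp_smul volume (fun z => twoPoleKernel s x y (x + z)),
      integral_add_left_eq_self] at h
    simp_rw [hsim] at h
    rw [integral_const_mul, abs_of_pos (by positivity), smul_eq_mul, eq_inv_mul_iff_mul_eq₀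
      (by positivity)] at h
    rw [← h, norm_sub_rev x y, Real.rpow_sub hr, Real.rpow_natCast, inv_div]
    ring

end RieszComposition

/-- The preliminary identity
`1/|x-y|^{N-α} = K ∫ dz / (|x-z|^{(2N-α)/2} |y-z|^{(2N-α)/2})`, with the integral on the
right-hand side finite for `x ≠ y`. -/
theorem statement6 (N : ℕ) (α : ℝ) (hα : 0 < α) (hαN : α < N) :
    ∃ K : ℝ, 0 < K ∧ ∀ x y : ES N, x ≠ y →
      Integrable (fun z : ES N =>
        (‖x - z‖ ^ ((2 * (N : ℝ) - α) / 2) * ‖y - z‖ ^ ((2 * (N : ℝ) - α) / 2))⁻¹) volume ∧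
      (‖x - y‖ ^ ((N : ℝ) - α))⁻¹
        = K * ∫ z : ES N,
            (‖x - z‖ ^ ((2 * (N : ℝ) - α) / 2) * ‖y - z‖ ^ ((2 * (N : ℝ) - α) / 2))⁻¹ := by
  have hN : 0 < N := by exact_mod_cast hα.trans hαN
  have hdim : finrank ℝ (ES N) = N := finrank_euclideanSpace_fin
  have he : ‖(EuclideanSpace.single ⟨0, hN⟩ 1 : ES N)‖ = 1 := by simp
  have hint := integrable_twoPoleKernel_unit (s := (2 * (N : ℝ) - α) / 2) (by linarith)
    (by rw [hdim]; linarith) (by rw [hdim]; linarith) he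
  have hpos := integral_twoPoleKernel_unit_pos he hint
  refine ⟨_, inv_pos.2 hpos, fun x y hxy => ?_⟩
  obtain ⟨h1, h2⟩ := integrable_and_integral_twoPoleKernel hxy he hint
  refine ⟨h1, ?_⟩
  rw [hdim, show 2 * ((2 * (N : ℝ) - α) / 2) - N = N - α by ring] at h2
  change _ = _ * ∫ z, twoPoleKernel _ x y z
  rw [h2, mul_comm, mul_inv_cancel_right₀ hpos.ne']
end
end

section
/- Let N ∈ ℕ, 0 < α < N and let p, q be real numbers with max{1, 2α/N} < p, q, with p < 2N/(N−2) and q < 2N/(N−2) in case N ≥ 3, and with 2(N+α)/N < p + q, with p + q < 2(N+α)/(N−2) in case N ≥ 3. Then there exist θ₁, θ₂ ∈ (1, N/α) such that 1/θ₁ + 1/θ₂ = (N+α)/N, 2 < θ₁p, 2 < θ₂q, and, in case N ≥ 3, θ₁p < 2N/(N−2) and θ₂q < 2N/(N−2). -/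
/-- Reciprocal form: `1 + a` splits as `x + y` with `x, y ∈ (a, 1)`, `t * p < x < p / 2` and
`t * q < y < q / 2`. -/
theorem exists_add_eq_one_add_of_bounds {a p q t : ℝ} (ha : a < 1) (hp : 0 < p) (hq : 0 < q)
    (hap : 2 * a < p) (haq : 2 * a < q) (hpq : 2 * (1 + a) < p + q)
    (ht : t < 1 / 2) (htp : t * p < 1) (htq : t * q < 1) (htpq : t * (p + q) < 1 + a) :
    ∃ x y : ℝ, x + y = 1 + a ∧ a < x ∧ x < 1 ∧ a < y ∧ y < 1 ∧
      x < p / 2 ∧ y < q / 2 ∧ t * p < x ∧ t * q < y := by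
  have hp' : t * p < p / 2 := by nlinarith
  have hq' : t * q < q / 2 := by nlinarith
  have h : max a (max (t * p) (1 + a - q / 2)) < min 1 (min (p / 2) (1 + a - t * q)) := by
    simp only [max_lt_iff, lt_min_iff]
    refine ⟨⟨?_, ?_, ?_⟩, ⟨?_, ?_, ?_⟩, ?_, ?_, ?_⟩ <;> linarith
  obtain ⟨x, hx₁, hx₂⟩ := exists_between h
  simp only [max_lt_iff, lt_min_iff] at hx₁ hx₂
  obtain ⟨h₁, h₂, h₃⟩ := hx₁
  obtain ⟨h₄, h₅, h₆⟩ := hx₂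
  refine ⟨x, 1 + a - x, ?_, ?_, ?_, ?_, ?_, ?_, ?_, ?_, ?_⟩ <;> linarith


/-- Under hypothesis (H₁) there exist exponents `θ₁, θ₂ ∈ (1, N/α)` with
`1/θ₁ + 1/θ₂ = (N+α)/N` and `2 < θ₁p, θ₂q < 2*` (the upper bound only being imposed when
`N ≥ 3`). -/
theorem statement8
    (N : ℕ) (α p q : ℝ) (hα : 0 < α) (hαN : α < N)
    (hp1 : 1 < p) (hp2 : 2 * α / N < p)
    (hq1 : 1 < q) (hq2 : 2 * α / N < q)
    (hpN : 3 ≤ N → p < 2 * N / (N - 2))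
    (hqN : 3 ≤ N → q < 2 * N / (N - 2))
    (hpq : 2 * (N + α) / N < p + q)
    (hpqN : 3 ≤ N → p + q < 2 * (N + α) / (N - 2)) :
    ∃ θ₁ θ₂ : ℝ,
      1 < θ₁ ∧ θ₁ < N / α ∧ 1 < θ₂ ∧ θ₂ < N / α ∧
      1 / θ₁ + 1 / θ₂ = (N + α) / N ∧
      2 < θ₁ * p ∧ 2 < θ₂ * q ∧
      (3 ≤ N → θ₁ * p < 2 * N / (N - 2) ∧ θ₂ * q < 2 * N / (N - 2)) := by
  have hN : (0 : ℝ) < N := hα.trans hαN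
  obtain ⟨t, ht, htp, htq, htpq, htN⟩ : ∃ t : ℝ, t < 1 / 2 ∧ t * p < 1 ∧ t * q < 1 ∧
      t * (p + q) < 1 + α / N ∧ (3 ≤ N → 0 < t ∧ 2 * (N : ℝ) / (N - 2) = 1 / t) := by
    by_cases h : 3 ≤ N
    · have h2 : (0 : ℝ) < N - 2 := by
        have : (3 : ℝ) ≤ N := by exact_mod_cast h
        linarith
      have hp := hpN h
      have hq := hqN h
      have hs := hpqN h
      rw [lt_div_iff₀ h2] at hp hq hs
      refine ⟨(N - 2) / (2 * N), ?_, ?_, ?_, ?_, fun _ => ⟨by positivity, by field_simp⟩⟩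
      · rw [div_lt_div_iff₀ (by positivity) two_pos]
        linarith
      · rw [div_mul_eq_mul_div, div_lt_one (by positivity)]
        linarith
      · rw [div_mul_eq_mul_div, div_lt_one (by positivity)]
        linarith
      · rw [div_mul_eq_mul_div, div_lt_iff₀ (by positivity)]
        have : (1 + α / N) * (2 * N) = 2 * (N + α) := by field_simp
        linarith
    · have : 0 < α / N := by positivity
      exact ⟨0, by norm_num, by simp, by simp, by linarith, fun h' => absurd h' h⟩
  have hsum : 1 + α / N = (N + α) / N := by field_simp
  have ha : 0 < α / N := by positivity
  obtain ⟨x, y, hxy, hax, hx1, hay, hy1, hxp, hyq, htx, hty⟩ :=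
    exists_add_eq_one_add_of_bounds (a := α / N) ((div_lt_one hN).2 hαN)
      (zero_lt_one.trans hp1) (zero_lt_one.trans hq1)
      (by rwa [← mul_div_assoc]) (by rwa [← mul_div_assoc])
      (by rwa [hsum, ← mul_div_assoc]) ht htp htq htpq
  have hx : 0 < x := ha.trans hax
  have hy : 0 < y := ha.trans hay
  refine ⟨1 / x, 1 / y, one_lt_one_div hx hx1, ?_, one_lt_one_div hy hy1, ?_, ?_, ?_, ?_, ?_⟩
  · simpa using one_div_lt_one_div_of_lt ha hax
  · simpa using one_div_lt_one_div_of_lt ha hay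
  · rw [one_div_one_div, one_div_one_div, hxy, hsum]
  · rw [one_div_mul_eq_div, lt_div_iff₀ hx]
    linarith
  · rw [one_div_mul_eq_div, lt_div_iff₀ hy]
    linarith
  · intro h
    obtain ⟨ht0, hS⟩ := htN h
    rw [hS, one_div_mul_eq_div, one_div_mul_eq_div, div_lt_div_iff₀ hx ht0,
      div_lt_div_iff₀ hy ht0]
    constructor <;> linarith
end
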